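/- arXiv:1807.07840 — 6 statements merged into one kernel-verified Lean document; each statement's English description precedes it below -/
import Mathlib

section
/- Let L be an N×N real Laplacian matrix of a nonnegatively weighted directed graph. Then the zero eigenvalue of L is semisimple, i.e., its algebraic multiplicity equals its geometric multiplicity; equivalently, ker(L·L) = ker(L). -/
/-- An `N × N` real matrix is a Laplacian matrix of a nonnegatively weighted directed
graph: all off-diagonal entries are nonpositive and every row sums to zero. -/
def IsLaplacian {N : ℕ} (L : Matrix (Fin N) (Fin N) ℝ) : Prop :=
  (∀ i j, i ≠ j → L i j ≤ 0) ∧ (∀ i, ∑ j, L i j = 0)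

open Matrix in
/-- Maximum principle: `L *ᵥ u` is nonnegative wherever `u` attains its maximum. -/
lemma IsLaplacian.mulVec_nonneg_of_forall_le {N : ℕ} {L : Matrix (Fin N) (Fin N) ℝ}
    (hL : IsLaplacian L) {u : Fin N → ℝ} {m : Fin N} (hm : ∀ j, u j ≤ u m) :
    0 ≤ (L *ᵥ u) m := by
  have h : (L *ᵥ u) m = ∑ j, L m j * (u j - u m) := by
    simp only [mulVec, dotProduct, mul_sub, Finset.sum_sub_distrib, ← Finset.sum_mul, hL.2 m,
      zero_mul, sub_zero]
  rw [h]
  refine Finset.sum_nonneg fun j _ => ?_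
  rcases eq_or_ne m j with rfl | hj
  · simp
  · exact mul_nonneg_of_nonpos_of_nonpos (hL.1 m j hj) (sub_nonpos.2 (hm j))

open Matrix in
/-- If `L *ᵥ x` lies in the kernel of `L`, then it is nonnegative: otherwise the maximum of
`x - t • L *ᵥ x` would exceed that of `x` for large `t`, contradicting the maximum principle. -/
lemma IsLaplacian.mulVec_nonneg_of_mulVec_mulVec_eq_zero {N : ℕ}
    {L : Matrix (Fin N) (Fin N) ℝ} (hL : IsLaplacian L) {x : Fin N → ℝ}
    (hx : L *ᵥ (L *ᵥ x) = 0) (i : Fin N) : 0 ≤ (L *ᵥ x) i := by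
  by_contra! hi
  have : Nonempty (Fin N) := ⟨i⟩
  obtain ⟨k, hk⟩ := Finite.exists_max x
  set y := L *ᵥ x with hy
  set t := (x k - x i + 1) / (-y i) with ht
  have ht0 : 0 ≤ t := div_nonneg (by linarith [hk i]) (by linarith)
  have hti : t * y i = -(x k - x i + 1) := by
    rw [ht]
    field_simp [hi.ne]
  obtain ⟨m, hm⟩ := Finite.exists_max (x - t • y)
  have hym := hL.mulVec_nonneg_of_forall_le hm
  rw [mulVec_sub, mulVec_smul, hx, smul_zero, sub_zero, ← hy] at hym
  have hmi := hm i
  simp only [Pi.sub_apply, Pi.smul_apply, smul_eq_mul] at hmi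
  linarith [mul_nonneg ht0 hym, hk m]

/-- The zero eigenvalue of a Laplacian matrix is semisimple:
`ker (L * L) = ker L`. -/
theorem laplacian_zero_eigenvalue_semisimple {N : ℕ}
    (L : Matrix (Fin N) (Fin N) ℝ) (hL : IsLaplacian L) :
    LinearMap.ker (Matrix.toLin' (L * L)) = LinearMap.ker (Matrix.toLin' L) := by
  ext x
  simp only [LinearMap.mem_ker, Matrix.toLin'_apply, ← Matrix.mulVec_mulVec]
  refine ⟨fun hx => ?_, fun hx => by rw [hx, Matrix.mulVec_zero]⟩
  have hneg : L.mulVec (L.mulVec (-x)) = 0 := by simp only [Matrix.mulVec_neg, hx, neg_zero]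
  ext i
  have h₁ := hL.mulVec_nonneg_of_mulVec_mulVec_eq_zero hx i
  have h₂ := hL.mulVec_nonneg_of_mulVec_mulVec_eq_zero hneg i
  rw [Matrix.mulVec_neg, Pi.neg_apply] at h₂
  exact le_antisymm (neg_nonneg.1 h₂) h₁
end

section
/- Let L_1,…,L_p be N×N Laplacian matrices of nonnegatively weighted directed graphs whose union graph contains a directed spanning tree. Then ⋂_{j=1}^p ker(L_j) = span{1_N}, where 1_N denotes the all-ones vector in ℝ^N. -/
/-- The union graph of the Laplacians `L k` has a directed edge from `j` to `i`
(`i ≠ j`) whenever `(L k) i j < 0` for some `k`; it contains a directed spanning tree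
if some root `r` has a directed path to every node. -/
def UnionHasSpanningTree {N p : ℕ} (L : Fin p → Matrix (Fin N) (Fin N) ℝ) : Prop :=
  ∃ r : Fin N, ∀ i : Fin N,
    Relation.ReflTransGen (fun a b => a ≠ b ∧ ∃ k, (L k) b a < 0) r i

/-- Maximum principle: at a maximum `b` of `x` where `L x` vanishes, every in-neighbour `a` of `b`
is also a maximum. -/
theorem IsLaplacian.eq_of_forall_le {N : ℕ} {L : Matrix (Fin N) (Fin N) ℝ} (hL : IsLaplacian L)
    {x : Fin N → ℝ} {a b : Fin N} (hx : L.mulVec x b = 0) (hmax : ∀ j, x j ≤ x b)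
    (hab : L b a < 0) : x a = x b := by
  have hsum : ∑ j, L b j * (x j - x b) = 0 := by
    have h : ∑ j, L b j * x j = 0 := hx
    simp [mul_sub, Finset.sum_sub_distrib, ← Finset.sum_mul, hL.2 b, h]
  have hnonneg : ∀ j ∈ Finset.univ, 0 ≤ L b j * (x j - x b) := by
    intro j _
    rcases eq_or_ne b j with rfl | hne
    · simp
    · exact mul_nonneg_of_nonpos_of_nonpos (hL.1 b j hne) (sub_nonpos.2 (hmax j))
  have hzero := (Finset.sum_eq_zero_iff_of_nonneg hnonneg).1 hsum a (Finset.mem_univ a)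
  exact sub_eq_zero.1 ((mul_eq_zero.1 hzero).resolve_left hab.ne)

/-- A node from which every node can be reached in the union graph is a maximum of every vector in
the common kernel. -/
theorem le_root_of_forall_mulVec_eq_zero {N p : ℕ} {L : Fin p → Matrix (Fin N) (Fin N) ℝ}
    (hLap : ∀ k, IsLaplacian (L k)) {r : Fin N}
    (hr : ∀ i, Relation.ReflTransGen (fun a b => a ≠ b ∧ ∃ k, (L k) b a < 0) r i)
    {x : Fin N → ℝ} (hx : ∀ k, (L k).mulVec x = 0) (i : Fin N) : x i ≤ x r := by
  have hpath : ∀ m, Relation.ReflTransGen (fun a b => a ≠ b ∧ ∃ k, (L k) b a < 0) r m →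
      (∀ j, x j ≤ x m) → x r = x m := by
    intro m hm
    induction hm with
    | refl => exact fun _ => rfl
    | tail _ hbc ih =>
      intro hmax
      obtain ⟨-, k, hk⟩ := hbc
      have h := (hLap k).eq_of_forall_le (congrFun (hx k) _) hmax hk
      exact (ih fun j => (hmax j).trans h.ge).trans h
  have : Nonempty (Fin N) := ⟨r⟩
  obtain ⟨m, hm⟩ := Finite.exists_max x
  exact (hm i).trans (hpath m (hr m) hm).ge

/-- If the union graph of the Laplacians `L 1, …, L p` contains a directed spanning
tree, then `⋂ⱼ ker (L j) = span {1}`. -/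
theorem inter_ker_laplacians_eq_span_one {N p : ℕ}
    (L : Fin p → Matrix (Fin N) (Fin N) ℝ)
    (hLap : ∀ k, IsLaplacian (L k))
    (htree : UnionHasSpanningTree L) :
    (⨅ k, LinearMap.ker (Matrix.toLin' (L k))) =
      Submodule.span ℝ {(fun _ => 1 : Fin N → ℝ)} := by
  obtain ⟨r, hr⟩ := htree
  ext x
  simp only [Submodule.mem_iInf, LinearMap.mem_ker, Matrix.toLin'_apply,
    Submodule.mem_span_singleton]
  constructor
  · intro hx
    refine ⟨x r, funext fun i => ?_⟩
    have hle := le_root_of_forall_mulVec_eq_zero hLap hr hx i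
    have hge := le_root_of_forall_mulVec_eq_zero hLap hr (x := -x)
      (fun k => by rw [Matrix.mulVec_neg, hx k, neg_zero]) i
    simpa using le_antisymm (neg_le_neg_iff.1 hge) hle
  · rintro ⟨c, rfl⟩ k
    ext i
    simp [Matrix.mulVec, dotProduct, ← Finset.sum_mul, (hLap k).2 i]
end

section
/- Let N ≥ 2 and let L_1,…,L_p be N×N Laplacian matrices of nonnegatively weighted directed graphs such that the union graph (equivalently, the digraph associated with L_1 + ⋯ + L_p) contains a directed spanning tree. Then ⋂_{j=1}^p ker(L̃_j^{N−1}) = {0}; that is, the generalized eigenspaces of the eigenvalue 0 of the reduced matrices L̃_j intersect trivially. -/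
/-- The involutive matrix `Δ` (here for `N = m + 2`): its first row is `e₁`, and its
`i`-th row for `i ≥ 2` is `e₁ − e_i`. -/
def Delta (m : ℕ) : Matrix (Fin (m + 2)) (Fin (m + 2)) ℝ :=
  fun i j => if j = 0 then 1 else if j = i then -1 else 0

/-- The reduced matrix `L̃`: the lower-right `(N−1) × (N−1)` block of `Δ L Δ`. -/
def reduced {m : ℕ} (L : Matrix (Fin (m + 2)) (Fin (m + 2)) ℝ) :
    Matrix (Fin (m + 1)) (Fin (m + 1)) ℝ :=
  fun i j => (Delta m * L * Delta m) i.succ j.succ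

namespace IsLaplacian

variable {N : ℕ} {L : Matrix (Fin N) (Fin N) ℝ}

theorem mulVec_apply (hL : IsLaplacian L) (y : Fin N → ℝ) (i : Fin N) :
    (L.mulVec y) i = ∑ j, L i j * (y j - y i) := by
  simp only [mul_sub, Finset.sum_sub_distrib, ← Finset.sum_mul, hL.2 i, zero_mul, sub_zero]
  rfl

/-- The local maximum principle for Laplacian matrices. -/
theorem eq_of_isMax (hL : IsLaplacian L) {y : Fin N → ℝ} {i : Fin N}
    (hy : (L.mulVec y) i = 0) (hmax : ∀ j, y j ≤ y i) {a : Fin N} (ha : L i a < 0) :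
    y a = y i := by
  rw [hL.mulVec_apply] at hy
  have hnonneg : ∀ j ∈ Finset.univ, 0 ≤ L i j * (y j - y i) := by
    intro j _
    by_cases hij : i = j
    · simp [hij]
    · exact mul_nonneg_of_nonpos_of_nonpos (hL.1 i j hij) (sub_nonpos.2 (hmax j))
  have h := (Finset.sum_eq_zero_iff_of_nonneg hnonneg).1 hy a (Finset.mem_univ a)
  exact sub_eq_zero.1 ((mul_eq_zero.1 h).resolve_left ha.ne)

theorem mulVec_nonpos_of_mulVec_mulVec_eq_zero (hL : IsLaplacian L) {y : Fin N → ℝ}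
    (hy : L.mulVec (L.mulVec y) = 0) (i : Fin N) : (L.mulVec y) i ≤ 0 := by
  obtain ⟨s, -, hs⟩ := Finset.exists_max_image Finset.univ (L.mulVec y) ⟨i, Finset.mem_univ i⟩
  obtain ⟨b, hb, hbmin⟩ := Finset.exists_min_image
    (Finset.univ.filter fun j => (L.mulVec y) j = (L.mulVec y) s) y ⟨s, by simp⟩
  simp only [Finset.mem_filter, Finset.mem_univ, true_and] at hb hbmin
  have hbmax : ∀ j, (L.mulVec y) j ≤ (L.mulVec y) b :=
    fun j => hb ▸ hs j (Finset.mem_univ j)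
  refine (hbmax i).trans ?_
  rw [hL.mulVec_apply]
  refine Finset.sum_nonpos fun j _ => ?_
  by_cases hbj : b = j
  · simp [hbj]
  rcases (hL.1 b j hbj).lt_or_eq with hlt | heq
  · have hj := hL.eq_of_isMax (congrFun hy b) hbmax hlt
    exact mul_nonpos_of_nonpos_of_nonneg hlt.le (sub_nonneg.2 (hbmin j (hj.trans hb)))
  · simp [heq]

/-- The eigenvalue `0` of a Laplacian matrix has no generalized eigenvectors of rank two. -/
theorem mulVec_eq_zero_of_mulVec_mulVec_eq_zero (hL : IsLaplacian L) {y : Fin N → ℝ}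
    (hy : L.mulVec (L.mulVec y) = 0) : L.mulVec y = 0 := by
  funext i
  refine le_antisymm (hL.mulVec_nonpos_of_mulVec_mulVec_eq_zero hy i) ?_
  have h := hL.mulVec_nonpos_of_mulVec_mulVec_eq_zero (y := -y)
    (by simp [Matrix.mulVec_neg, hy]) i
  simpa [Matrix.mulVec_neg] using h

theorem mulVec_eq_zero_of_pow_succ_mulVec_eq_zero (hL : IsLaplacian L) {y : Fin N → ℝ} (n : ℕ)
    (hy : (L ^ (n + 1)).mulVec y = 0) : L.mulVec y = 0 := by
  induction n with
  | zero => simpa using hy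
  | succ n ih =>
    refine ih ?_
    rw [pow_succ', ← Matrix.mulVec_mulVec]
    apply hL.mulVec_eq_zero_of_mulVec_mulVec_eq_zero
    rwa [Matrix.mulVec_mulVec, Matrix.mulVec_mulVec, mul_assoc, ← pow_succ', ← pow_succ']

theorem mulVec_eq_zero_of_forall_eq (hL : IsLaplacian L) {w : Fin N → ℝ}
    (hw : ∀ i j, w i = w j) : L.mulVec w = 0 := by
  funext i
  rw [hL.mulVec_apply]
  exact Finset.sum_eq_zero fun j _ => by simp [hw j i]

end IsLaplacian

theorem UnionHasSpanningTree.eq_of_forall_mulVec_eq_zero {N p : ℕ}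
    {L : Fin p → Matrix (Fin N) (Fin N) ℝ} (hLap : ∀ k, IsLaplacian (L k))
    (htree : UnionHasSpanningTree L) {y : Fin N → ℝ} (hy : ∀ k, (L k).mulVec y = 0)
    (i j : Fin N) : y i = y j := by
  obtain ⟨r, hr⟩ := htree
  have le_root : ∀ y : Fin N → ℝ, (∀ k, (L k).mulVec y = 0) → ∀ i, y i ≤ y r := by
    intro y hy i
    obtain ⟨s, -, hs⟩ := Finset.exists_max_image Finset.univ y ⟨i, Finset.mem_univ i⟩
    have hback : y r = y s := by
      have hrs := hr s
      clear hr
      induction hrs using Relation.ReflTransGen.head_induction_on with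
      | refl => rfl
      | head hab _ ih =>
        obtain ⟨-, k, hk⟩ := hab
        rw [← ih]
        refine (hLap k).eq_of_isMax (congrFun (hy k) _) (fun j => ?_) hk
        exact ih ▸ hs j (Finset.mem_univ j)
    exact hback ▸ hs i (Finset.mem_univ i)
  have eq_root : ∀ i, y i = y r := fun i =>
    le_antisymm (le_root y hy i)
      (neg_le_neg_iff.1 (le_root (-y) (fun k => by simp [Matrix.mulVec_neg, hy k]) i))
  rw [eq_root i, eq_root j]

theorem reduced_apply {m : ℕ} (L : Matrix (Fin (m + 2)) (Fin (m + 2)) ℝ) (i j : Fin (m + 1)) :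
    reduced L i j = L i.succ j.succ - L 0 j.succ := by
  have hcol : ∀ a, (Delta m * L) i.succ a = L 0 a - L i.succ a := by
    intro a
    simp [Matrix.mul_apply, Delta, Fin.sum_univ_succ, Fin.succ_ne_zero, ite_mul, sub_eq_add_neg]
  simp [reduced, Matrix.mul_apply (M := Delta m * L), hcol, Delta, Fin.sum_univ_succ (n := m + 1),
    Fin.succ_ne_zero]

/-- The differences of the entries of a vector with its first entry intertwine a Laplacian
matrix with its reduced matrix. -/
theorem IsLaplacian.reduced_mulVec {m : ℕ} {L : Matrix (Fin (m + 2)) (Fin (m + 2)) ℝ}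
    (hL : IsLaplacian L) (y : Fin (m + 2) → ℝ) :
    (reduced L).mulVec (fun i => y i.succ - y 0) =
      fun i => (L.mulVec y) i.succ - (L.mulVec y) 0 := by
  have hrow : ∀ a, (L.mulVec y) a = ∑ j : Fin (m + 1), L a j.succ * (y j.succ - y 0) := by
    intro a
    have h := hL.2 a
    rw [Fin.sum_univ_succ] at h
    simp only [mul_sub, Finset.sum_sub_distrib, ← Finset.sum_mul]
    rw [Matrix.mulVec, dotProduct, Fin.sum_univ_succ]
    linear_combination y 0 * h
  funext i
  rw [hrow, hrow, ← Finset.sum_sub_distrib]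
  rw [Matrix.mulVec, dotProduct]
  exact Finset.sum_congr rfl fun j _ => by rw [reduced_apply, sub_mul]

theorem IsLaplacian.reduced_pow_mulVec {m : ℕ} {L : Matrix (Fin (m + 2)) (Fin (m + 2)) ℝ}
    (hL : IsLaplacian L) (n : ℕ) (y : Fin (m + 2) → ℝ) :
    (reduced L ^ n).mulVec (fun i => y i.succ - y 0) =
      fun i => ((L ^ n).mulVec y) i.succ - ((L ^ n).mulVec y) 0 := by
  induction n with
  | zero => simp
  | succ n ih =>
    rw [pow_succ', ← Matrix.mulVec_mulVec, ih, hL.reduced_mulVec, Matrix.mulVec_mulVec,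
      ← pow_succ']

/-- If the union graph of Laplacians `L 1, …, L p` of size `N = m + 2 ≥ 2` contains a
directed spanning tree, then the generalized eigenspaces of the eigenvalue `0` of the
reduced matrices `L̃ⱼ` intersect trivially: `⋂ⱼ ker (L̃ⱼ^(N−1)) = {0}`. -/
theorem inter_generalized_zero_eigenspaces_reduced_eq_bot {m p : ℕ}
    (L : Fin p → Matrix (Fin (m + 2)) (Fin (m + 2)) ℝ)
    (hLap : ∀ k, IsLaplacian (L k))
    (htree : UnionHasSpanningTree L) :
    (⨅ k, LinearMap.ker (Matrix.toLin' ((reduced (L k)) ^ (m + 1)))) = ⊥ := by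
  refine (Submodule.eq_bot_iff _).2 fun x hx => ?_
  simp only [Submodule.mem_iInf, LinearMap.mem_ker, Matrix.toLin'_apply] at hx
  set y : Fin (m + 2) → ℝ := Fin.cons 0 x with hy
  have hyx : (fun i : Fin (m + 1) => y i.succ - y 0) = x := by
    funext i
    simp [hy]
  have hker : ∀ k, (L k).mulVec y = 0 := by
    intro k
    have h := (hLap k).reduced_pow_mulVec (m + 1) y
    rw [hyx, hx k] at h
    have hconst : ∀ i, (L k ^ (m + 1)).mulVec y i = (L k ^ (m + 1)).mulVec y 0 :=
      Fin.cases rfl fun i => sub_eq_zero.1 (congrFun h i).symm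
    refine (hLap k).mulVec_eq_zero_of_pow_succ_mulVec_eq_zero (m + 1) ?_
    rw [pow_succ', ← Matrix.mulVec_mulVec]
    exact (hLap k).mulVec_eq_zero_of_forall_eq fun i j => (hconst i).trans (hconst j).symm
  rw [← hyx]
  funext i
  exact sub_eq_zero.2 (htree.eq_of_forall_mulVec_eq_zero hLap hker i.succ 0)
end

section
/- Let L_1,…,L_p be N×N Laplacian matrices of nonnegatively weighted directed graphs whose union graph contains a directed spanning tree, and let n ≥ 1. Then {x ∈ ℝ^{N·n} : (L_j ⊗ I_n)·x = 0 for all j = 1,…,p} = {1_N ⊗ u : u ∈ ℝ^n}, where ⊗ denotes the Kronecker product and 1_N is the all-ones vector in ℝ^N. Equivalently, writing x = (x_1,…,x_N) with blocks x_i ∈ ℝ^n, all the synchronization error variables vanish simultaneously if and only if x_1 = x_2 = ⋯ = x_N. -/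
open Kronecker

/-- Maximum principle: if `y` is annihilated by a Laplacian and is maximal at `b`, then `y` takes
the same value at every in-neighbour of `b`. -/
lemma IsLaplacian.eq_of_neg_of_forall_le {N : ℕ} {L : Matrix (Fin N) (Fin N) ℝ}
    (hL : IsLaplacian L) {y : Fin N → ℝ} (hy : L.mulVec y = 0) {a b : Fin N}
    (hmax : ∀ i, y i ≤ y b) (hab : L b a < 0) : y a = y b := by
  have hsum : ∑ j, L b j * (y j - y b) = 0 := by
    have h : ∑ j, L b j * y j = 0 := congrFun hy b
    simp [mul_sub, Finset.sum_sub_distrib, ← Finset.sum_mul, h, hL.2 b]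
  have hnonneg : ∀ j ∈ Finset.univ, 0 ≤ L b j * (y j - y b) := by
    intro j _
    rcases eq_or_ne b j with rfl | hj
    · simp
    · exact mul_nonneg_of_nonpos_of_nonpos (hL.1 b j hj) (sub_nonpos.2 (hmax j))
  have h := (Finset.sum_eq_zero_iff_of_nonneg hnonneg).1 hsum a (Finset.mem_univ a)
  exact sub_eq_zero.1 ((mul_eq_zero.1 h).resolve_left hab.ne)

/-- A maximum over the nodes propagates backwards along directed paths, so a root of the union
graph attains the maximum of any vector in the joint kernel. -/
lemma le_root_of_joint_kernel {N p : ℕ} {L : Fin p → Matrix (Fin N) (Fin N) ℝ}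
    (hLap : ∀ k, IsLaplacian (L k)) {r : Fin N}
    (hr : ∀ i, Relation.ReflTransGen (fun a b => a ≠ b ∧ ∃ k, (L k) b a < 0) r i)
    {y : Fin N → ℝ} (hy : ∀ k, (L k).mulVec y = 0) (i : Fin N) : y i ≤ y r := by
  have : Nonempty (Fin N) := ⟨r⟩
  obtain ⟨m, hm⟩ := Finite.exists_max y
  refine (hr m).head_induction_on (motive := fun a _ => ∀ i, y i ≤ y a) hm ?_ i
  rintro a c ⟨-, k, hk⟩ - hc i
  exact ((hLap k).eq_of_neg_of_forall_le (hy k) hc hk).symm ▸ hc i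

/-- `A ⊗ I` acts on each coordinate slice of a block vector as `A`. -/
lemma kronecker_one_mulVec_apply {N n : ℕ} (A : Matrix (Fin N) (Fin N) ℝ)
    (x : Fin N × Fin n → ℝ) (i : Fin N) (k : Fin n) :
    (A ⊗ₖ (1 : Matrix (Fin n) (Fin n) ℝ)).mulVec x (i, k) =
      A.mulVec (fun j => x (j, k)) i := by
  simp [Matrix.mulVec, dotProduct, Fintype.sum_prod_type, Matrix.one_apply]

/-- If the union graph of the Laplacians `L 1, …, L p` contains a directed spanning
tree, then the set of `x ∈ ℝ^{N·n}` with `(L j ⊗ I_n) x = 0` for all `j` is exactly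
the set of vectors of the form `1_N ⊗ u`, `u ∈ ℝ^n`; i.e. all blocks of `x` agree. -/
theorem joint_kernel_kronecker_eq_synchronized {N p n : ℕ} (hn : 1 ≤ n)
    (L : Fin p → Matrix (Fin N) (Fin N) ℝ)
    (hLap : ∀ k, IsLaplacian (L k))
    (htree : UnionHasSpanningTree L) :
    {x : Fin N × Fin n → ℝ |
        ∀ j, ((L j) ⊗ₖ (1 : Matrix (Fin n) (Fin n) ℝ)).mulVec x = 0} =
      {x : Fin N × Fin n → ℝ | ∃ u : Fin n → ℝ, ∀ i k, x (i, k) = u k} := by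
  ext x
  simp only [Set.mem_ofPred_eq]
  constructor
  · intro hx
    obtain ⟨r, hr⟩ := htree
    refine ⟨fun k => x (r, k), fun i k => ?_⟩
    have hy : ∀ l, (L l).mulVec (fun j => x (j, k)) = 0 := fun l => funext fun j => by
      rw [← kronecker_one_mulVec_apply, hx l]
      rfl
    have hy' : ∀ l, (L l).mulVec (-fun j => x (j, k)) = 0 := fun l => by
      rw [Matrix.mulVec_neg, hy l, neg_zero]
    exact le_antisymm (le_root_of_joint_kernel hLap hr hy i)
      (neg_le_neg_iff.1 (le_root_of_joint_kernel hLap hr hy' i))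
  · rintro ⟨u, hu⟩ l
    ext ⟨i, k⟩
    rw [kronecker_one_mulVec_apply]
    simp [hu, Matrix.mulVec, dotProduct, ← Finset.sum_mul, (hLap l).2 i]
end

section
/- Let M be an N×N Laplacian matrix of a nonnegatively weighted directed graph whose associated digraph has reaches R_1,…,R_k, with exclusive parts H_i and common parts C_i. Then the nullspace of M has a basis v_1,…,v_k ∈ ℝ^N whose elements satisfy, for each i: (1) v_i(s) = 0 for every node s ∉ R_i; (2) v_i(s) = 1 for every s ∈ H_i; (3) v_i(s) ∈ (0,1) for every s ∈ C_i; and (4) v_1 + ⋯ + v_k = 1_N, the all-ones vector. -/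
/-- Directed edge from `j` to `i` (`i ≠ j`) whenever `M i j < 0`. -/
def adjOf {N : ℕ} (M : Matrix (Fin N) (Fin N) ℝ) (j i : Fin N) : Prop :=
  j ≠ i ∧ M i j < 0

/-- `reachFrom M j` is the set containing `j` and all nodes reachable from `j` by a
directed path. -/
def reachFrom {N : ℕ} (M : Matrix (Fin N) (Fin N) ℝ) (j : Fin N) : Set (Fin N) :=
  {i | Relation.ReflTransGen (adjOf M) j i}

/-- A reach is a maximal reachable set. -/
def IsReach {N : ℕ} (M : Matrix (Fin N) (Fin N) ℝ) (R : Set (Fin N)) : Prop :=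
  ∃ j, R = reachFrom M j ∧ ∀ i, ¬ (reachFrom M j ⊂ reachFrom M i)

/-- Local maximum principle: where a harmonic function dominates all in-neighbours, it equals
them. -/
theorem eq_of_adjOf_of_forall_le {N : ℕ} {M : Matrix (Fin N) (Fin N) ℝ} (hM : IsLaplacian M)
    {x : Fin N → ℝ} {s : Fin N} (hx : M.mulVec x s = 0)
    (hle : ∀ b, adjOf M b s → x b ≤ x s) {b : Fin N} (hb : adjOf M b s) : x b = x s := by
  have hsum : ∑ j, M s j * (x j - x s) = 0 := by
    simp only [mul_sub, Finset.sum_sub_distrib, ← Finset.sum_mul, hM.2 s]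
    simpa [Matrix.mulVec, dotProduct] using hx
  have hnonneg : ∀ j ∈ Finset.univ, 0 ≤ M s j * (x j - x s) := by
    intro j _
    by_cases hjs : j = s
    · simp [hjs]
    · have h0 := hM.1 s j (Ne.symm hjs)
      rcases h0.lt_or_eq with h | h
      · exact mul_nonneg_of_nonpos_of_nonpos h0 (sub_nonpos.2 (hle j ⟨hjs, h⟩))
      · simp [h]
  have h := (Finset.sum_eq_zero_iff_of_nonneg hnonneg).1 hsum b (Finset.mem_univ b)
  rcases mul_eq_zero.1 h with h | h
  · exact absurd h hb.2.ne
  · linarith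

/-- A harmonic function dominating its values at all ancestors of `s` is constant on them. -/
theorem eq_of_reflTransGen_of_forall_le {N : ℕ} {M : Matrix (Fin N) (Fin N) ℝ}
    (hM : IsLaplacian M) {x : Fin N → ℝ} (hx : M.mulVec x = 0) {s t : Fin N}
    (hle : ∀ b, Relation.ReflTransGen (adjOf M) b s → x b ≤ x s)
    (hts : Relation.ReflTransGen (adjOf M) t s) : x t = x s := by
  induction hts using Relation.ReflTransGen.head_induction_on with
  | refl => rfl
  | head hab hbs ih =>
    rw [← ih]
    refine eq_of_adjOf_of_forall_le hM (congrFun hx _) (fun d hd => ?_) hab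
    rw [ih]
    exact hle d (hbs.head hd)

/-- Maximum principle for functions harmonic outside a boundary set `Z` that reaches every node. -/
theorem le_of_forall_boundary_le {N : ℕ} {M : Matrix (Fin N) (Fin N) ℝ} (hM : IsLaplacian M)
    {Z : Set (Fin N)} (hZ : ∀ s, ∃ z ∈ Z, Relation.ReflTransGen (adjOf M) z s)
    {x : Fin N → ℝ} (hx : ∀ s ∉ Z, M.mulVec x s = 0) {s : Fin N} {m : ℝ}
    (hm : ∀ z ∈ Z, Relation.ReflTransGen (adjOf M) z s → x z ≤ m) : x s ≤ m := by
  obtain ⟨t, hts, htmax⟩ := Set.exists_max_image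
    {t | Relation.ReflTransGen (adjOf M) t s} x (Set.toFinite _) ⟨s, .refl⟩
  refine (htmax s .refl).trans ?_
  obtain ⟨z, hz, hzt⟩ := hZ t
  induction hzt with
  | refl => exact hm z hz hts
  | @tail b t _ hbt ih =>
    by_cases htZ : t ∈ Z
    · exact hm t htZ hts
    · have hbs : Relation.ReflTransGen (adjOf M) b s := Relation.ReflTransGen.head hbt hts
      have heq : x b = x t := eq_of_adjOf_of_forall_le hM (hx t htZ)
        (fun d hd => htmax d (Relation.ReflTransGen.head hd hts)) hbt
      rw [← heq]
      exact ih hbs fun d hd => heq ▸ htmax d hd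

theorem ge_of_forall_boundary_ge {N : ℕ} {M : Matrix (Fin N) (Fin N) ℝ} (hM : IsLaplacian M)
    {Z : Set (Fin N)} (hZ : ∀ s, ∃ z ∈ Z, Relation.ReflTransGen (adjOf M) z s)
    {x : Fin N → ℝ} (hx : ∀ s ∉ Z, M.mulVec x s = 0) {s : Fin N} {m : ℝ}
    (hm : ∀ z ∈ Z, Relation.ReflTransGen (adjOf M) z s → m ≤ x z) : m ≤ x s := by
  have h : (-x) s ≤ -m := le_of_forall_boundary_le hM hZ
    (fun s hs => by simp [Matrix.mulVec_neg, hx s hs])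
    (fun z hz hzs => neg_le_neg (hm z hz hzs))
  simpa using h

theorem eq_of_forall_boundary_eq {N : ℕ} {M : Matrix (Fin N) (Fin N) ℝ} (hM : IsLaplacian M)
    {Z : Set (Fin N)} (hZ : ∀ s, ∃ z ∈ Z, Relation.ReflTransGen (adjOf M) z s)
    {x : Fin N → ℝ} (hx : ∀ s ∉ Z, M.mulVec x s = 0) {s : Fin N} {m : ℝ}
    (hm : ∀ z ∈ Z, Relation.ReflTransGen (adjOf M) z s → x z = m) : x s = m :=
  le_antisymm (le_of_forall_boundary_le hM hZ hx fun z hz hzs => (hm z hz hzs).le)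
    (ge_of_forall_boundary_ge hM hZ hx fun z hz hzs => (hm z hz hzs).ge)

/-- The Dirichlet problem with boundary `Z` is solvable when `Z` reaches every node. -/
theorem exists_harmonic_extension {N : ℕ} {M : Matrix (Fin N) (Fin N) ℝ} (hM : IsLaplacian M)
    {Z : Set (Fin N)} (hZ : ∀ s, ∃ z ∈ Z, Relation.ReflTransGen (adjOf M) z s)
    (f : Fin N → ℝ) :
    ∃ x : Fin N → ℝ, (∀ s ∉ Z, M.mulVec x s = 0) ∧ ∀ z ∈ Z, x z = f z := by
  classical
  let B : Matrix (Fin N) (Fin N) ℝ := fun s => if s ∈ Z then Pi.single s 1 else M s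
  have hBmem : ∀ x, ∀ s ∈ Z, B.mulVec x s = x s := fun x s hs => by
    simp [B, Matrix.mulVec, hs]
  have hBnot : ∀ x, ∀ s ∉ Z, B.mulVec x s = M.mulVec x s := fun x s hs => by
    simp [B, Matrix.mulVec, hs]
  have hinj : Function.Injective B.mulVecLin := by
    rw [← LinearMap.ker_eq_bot, LinearMap.ker_eq_bot']
    intro x hx
    have hx' : ∀ s, B.mulVec x s = 0 := fun s => congrFun hx s
    ext s
    exact eq_of_forall_boundary_eq hM hZ (fun s hs => by rw [← hBnot x s hs, hx'])
      fun z hz _ => by rw [← hBmem x z hz, hx', Pi.zero_apply]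
  obtain ⟨x, hx⟩ := LinearMap.injective_iff_surjective.1 hinj (fun s => if s ∈ Z then f s else 0)
  have hx' : ∀ s, B.mulVec x s = if s ∈ Z then f s else 0 := fun s => congrFun hx s
  exact ⟨x, fun s hs => by rw [← hBnot x s hs, hx', if_neg hs],
    fun z hz => by rw [← hBmem x z hz, hx', if_pos hz]⟩

theorem reachFrom_subset_of_reflTransGen {N : ℕ} {M : Matrix (Fin N) (Fin N) ℝ} {a b : Fin N}
    (h : Relation.ReflTransGen (adjOf M) a b) : reachFrom M b ⊆ reachFrom M a :=
  fun _ hc => Relation.ReflTransGen.trans h hc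

theorem exists_isReach_mem {N : ℕ} (M : Matrix (Fin N) (Fin N) ℝ) (s : Fin N) :
    ∃ S, IsReach M S ∧ s ∈ S := by
  obtain ⟨j, hj, hmax⟩ := Set.exists_max_image {j | s ∈ reachFrom M j}
    (fun j => (reachFrom M j).ncard) (Set.toFinite _) ⟨s, Relation.ReflTransGen.refl⟩
  exact ⟨_, ⟨j, rfl, fun i hi =>
    (hmax i (hi.1 hj)).not_gt (Set.ncard_lt_ncard hi (Set.toFinite _))⟩, hj⟩

/-- For a Laplacian matrix `M` whose digraph has reaches `R 1, …, R k` with exclusive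
parts `H i = R i \ ⋃_{j ≠ i} R j` and common parts `C i = R i \ H i`, the nullspace of
`M` has a basis `v 1, …, v k` with `v i = 0` off `R i`, `v i = 1` on `H i`,
`v i ∈ (0,1)` on `C i`, and `∑ i, v i = 1`. -/
theorem laplacian_kernel_basis_of_reaches {N k : ℕ}
    (M : Matrix (Fin N) (Fin N) ℝ) (hM : IsLaplacian M)
    (R : Fin k → Set (Fin N))
    (hreach : ∀ i, IsReach M (R i))
    (hinj : Function.Injective R)
    (hall : ∀ S : Set (Fin N), IsReach M S → ∃ i, R i = S) :
    ∃ v : Fin k → (Fin N → ℝ),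
      LinearIndependent ℝ v ∧
      Submodule.span ℝ (Set.range v) = LinearMap.ker (Matrix.toLin' M) ∧
      (∀ i s, s ∉ R i → v i s = 0) ∧
      (∀ i s, s ∈ R i \ (⋃ j ∈ ({j | j ≠ i} : Set (Fin k)), R j) → v i s = 1) ∧
      (∀ i s, s ∈ R i \ (R i \ (⋃ j ∈ ({j | j ≠ i} : Set (Fin k)), R j)) →
        v i s ∈ Set.Ioo (0 : ℝ) 1) ∧
      (∑ i, v i) = (fun _ => 1) := by
  choose c hRc hcmax using hreach
  have hmem : ∀ i s, s ∈ R i ↔ Relation.ReflTransGen (adjOf M) (c i) s := fun i s => by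
    rw [hRc]; rfl
  have hroot : ∀ i j, Relation.ReflTransGen (adjOf M) (c i) (c j) → i = j := fun i j h => by
    have hsub := reachFrom_subset_of_reflTransGen h
    refine hinj ?_
    rw [hRc i, hRc j]
    by_contra hne
    exact hcmax j (c i) (hsub.ssubset_of_ne (Ne.symm hne))
  have hcov : ∀ s, ∃ z ∈ Set.range c, Relation.ReflTransGen (adjOf M) z s := fun s => by
    obtain ⟨S, hS, hs⟩ := exists_isReach_mem M s
    obtain ⟨i, rfl⟩ := hall S hS
    exact ⟨c i, ⟨i, rfl⟩, (hmem i s).1 hs⟩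
  have hcinj : Function.Injective c := fun i j h => hroot i j (h ▸ .refl)
  have hex : ∀ i, ∃ x : Fin N → ℝ, (∀ s ∉ Set.range c, M.mulVec x s = 0) ∧
      ∀ j, x (c j) = if i = j then 1 else 0 := fun i => by
    obtain ⟨x, hx, hx'⟩ := exists_harmonic_extension hM hcov (Pi.single (c i) 1)
    refine ⟨x, hx, fun j => ?_⟩
    simp [hx' (c j) ⟨j, rfl⟩, Pi.single_apply, hcinj.eq_iff, eq_comm]
  choose v hv hvc using hex
  have hconst : ∀ i s (m : ℝ), (∀ j, s ∈ R j → (if i = j then 1 else 0) = m) → v i s = m := by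
    intro i s m h
    refine eq_of_forall_boundary_eq hM hcov (hv i) ?_
    rintro _ ⟨j, rfl⟩ hj
    rw [hvc, h j ((hmem j s).2 hj)]
  have hker : ∀ i, M.mulVec (v i) = 0 := fun i => by
    ext s
    by_cases hs : s ∈ Set.range c
    · obtain ⟨j, rfl⟩ := hs
      have hterm : ∀ b, M (c j) b * v i b = M (c j) b * v i (c j) := fun b => by
        by_cases hb : b = c j
        · rw [hb]
        · rcases (hM.1 (c j) b (Ne.symm hb)).lt_or_eq with h | h
          · rw [hconst i b (v i (c j))]
            intro l hl
            rw [hvc, hroot l j (((hmem l b).1 hl).tail ⟨hb, h⟩)]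
          · simp [h]
      simp [Matrix.mulVec, dotProduct, hterm, ← Finset.sum_mul, hM.2]
    · exact hv i s hs
  have hexpand : ∀ x : Fin N → ℝ, M.mulVec x = 0 → ∑ i, x (c i) • v i = x := fun x hx => by
    have hd : M.mulVec (∑ i, x (c i) • v i - x) = 0 := by
      simp [Matrix.mulVec_sub, Matrix.mulVec_sum, Matrix.mulVec_smul, hker, hx]
    rw [← sub_eq_zero]
    ext s
    refine eq_of_forall_boundary_eq hM hcov (fun s _ => congrFun hd s) ?_
    rintro _ ⟨j, rfl⟩ -
    simp [hvc]
  have hnonneg : ∀ i s, 0 ≤ v i s := fun i s => by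
    refine ge_of_forall_boundary_ge hM hcov (hv i) ?_
    rintro _ ⟨j, rfl⟩ -
    rw [hvc]; split_ifs <;> norm_num
  have hle_one : ∀ i s, v i s ≤ 1 := fun i s => by
    refine le_of_forall_boundary_le hM hcov (hv i) ?_
    rintro _ ⟨j, rfl⟩ -
    rw [hvc]; split_ifs <;> norm_num
  refine ⟨v, ?_, ?_, ?_, ?_, ?_, ?_⟩
  · rw [Fintype.linearIndependent_iff]
    intro g hg j
    simpa [hvc] using congrFun hg (c j)
  · refine le_antisymm (Submodule.span_le.2 ?_) fun x hx => ?_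
    · rintro _ ⟨i, rfl⟩
      simpa using hker i
    · rw [← hexpand x (by simpa using hx)]
      exact Submodule.sum_mem _ fun i _ =>
        Submodule.smul_mem _ _ (Submodule.subset_span ⟨i, rfl⟩)
  · intro i s hs
    refine hconst i s 0 fun j hj => if_neg ?_
    rintro rfl
    exact hs hj
  · rintro i s ⟨-, hs⟩
    refine hconst i s 1 fun j hj => if_pos ?_
    by_contra hne
    exact hs (Set.mem_biUnion (Ne.symm hne : j ≠ i) hj)
  · rintro i s ⟨hsi, hs⟩
    have hU : s ∈ ⋃ j ∈ ({j | j ≠ i} : Set (Fin k)), R j := by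
      by_contra h
      exact hs ⟨hsi, h⟩
    obtain ⟨j, hji, hsj⟩ := Set.mem_iUnion₂.1 hU
    refine ⟨(hnonneg i s).lt_of_ne fun h0 => ?_, (hle_one i s).lt_of_ne fun h1 => ?_⟩
    · have hneg : M.mulVec (-v i) = 0 := by rw [Matrix.mulVec_neg, hker, neg_zero]
      have h := eq_of_reflTransGen_of_forall_le hM hneg (s := s)
        (fun b _ => by simpa [← h0] using hnonneg i b) ((hmem i s).1 hsi)
      simp [hvc, ← h0] at h
    · have h := eq_of_reflTransGen_of_forall_le hM (hker i) (s := s)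
        (fun b _ => h1 ▸ hle_one i b) ((hmem j s).1 hsj)
      rw [hvc, if_neg (Ne.symm hji), h1] at h
      exact zero_ne_one h
  · have hone : M.mulVec (fun _ => (1 : ℝ)) = 0 := by
      ext s
      simp [Matrix.mulVec, dotProduct, hM.2]
    simpa using hexpand _ hone
end

section
/- Let N, n ≥ 1, let L be an N×N real matrix, let Γ be an n×n diagonal matrix with positive diagonal entries, let Ξ be an N×N diagonal matrix with positive diagonal entries, and set c = λ_max(Ξ)/λ_min(Ξ). Let α > 0, ρ̄ ≥ 0, φ > 0, and t₀ < t₁. Suppose δ : [t₀, t₁] → ℝ^{N·n} is differentiable and satisfies δ'(t) = g(t) − φ (L ⊗ Γ) δ(t) for some function g with ‖g(t)‖ ≤ ρ̄ ‖δ(t)‖ for all t, and suppose that for all t ∈ [t₀, t₁], δ(t)ᵀ [(ΞL + LᵀΞ) ⊗ Γ] δ(t) ≥ α λ_min(Γ) δ(t)ᵀ (Ξ ⊗ I_n) δ(t). Then for all t ∈ [t₀, t₁], ‖δ(t)‖ ≤ √c · exp{(−(φ α λ_min(Γ))/2 + ρ̄ c)(t − t₀)} · ‖δ(t₀)‖,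 where ‖·‖ is the Euclidean norm. -/
open Matrix Kronecker
open scoped RealInnerProductSpace

/-- Grönwall's inequality on a closed interval, with a one-sided differential inequality. -/
theorem le_exp_mul_of_hasDerivWithinAt_le {V V' : ℝ → ℝ} {K a b : ℝ}
    (hV : ∀ u ∈ Set.Icc a b, HasDerivWithinAt V (V' u) (Set.Icc a b) u)
    (hle : ∀ u ∈ Set.Icc a b, V' u ≤ K * V u) :
    ∀ u ∈ Set.Icc a b, V u ≤ Real.exp (K * (u - a)) * V a := by
  intro u hu
  have hexp (s : ℝ) : HasDerivAt (fun t ↦ Real.exp (-K * (t - a)))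
      (Real.exp (-K * (s - a)) * -K) s := by
    simpa using (((hasDerivAt_id s).sub_const a).const_mul (-K)).exp
  have hderiv : ∀ s ∈ Set.Icc a b,
      HasDerivWithinAt (fun t ↦ Real.exp (-K * (t - a)) * V t)
        (Real.exp (-K * (s - a)) * -K * V s + Real.exp (-K * (s - a)) * V' s)
        (Set.Icc a b) s :=
    fun s hs ↦ (hexp s).hasDerivWithinAt.mul (hV s hs)
  have hanti : AntitoneOn (fun t ↦ Real.exp (-K * (t - a)) * V t) (Set.Icc a b) := by
    refine antitoneOn_of_hasDerivWithinAt_nonpos (convex_Icc a b)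
      (fun s hs ↦ (hderiv s hs).continuousWithinAt)
      (fun s hs ↦ (hderiv s (interior_subset hs)).mono interior_subset) fun s hs ↦ ?_
    nlinarith [hle s (interior_subset hs), Real.exp_pos (-K * (s - a))]
  have h := hanti (Set.left_mem_Icc.2 (hu.1.trans hu.2)) hu hu.1
  simp only [sub_self, mul_zero, Real.exp_zero, one_mul] at h
  calc V u = Real.exp (K * (u - a)) * (Real.exp (-K * (u - a)) * V u) := by
        rw [← mul_assoc, ← Real.exp_add]; simp
    _ ≤ _ := by gcongr

/-- Lyapunov estimate for `δ' = g - A δ` with the quadratic Lyapunov function `x ↦ ⟪x, P x⟫`. -/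
theorem norm_le_of_quadratic_lyapunov {E : Type*} [NormedAddCommGroup E] [InnerProductSpace ℝ E]
    {P : E →L[ℝ] E} {A : E → E} {δ g : ℝ → E} {m M β ρ a b : ℝ}
    (hP : P.IsSymmetric) (hm : 0 < m) (hρ : 0 ≤ ρ)
    (hmP : ∀ x, m * ‖x‖ ^ 2 ≤ ⟪x, P x⟫) (hPM : ∀ x, ‖P x‖ ≤ M * ‖x‖) (hM : 0 ≤ M)
    (hg : ∀ u ∈ Set.Icc a b, ‖g u‖ ≤ ρ * ‖δ u‖)
    (hode : ∀ u ∈ Set.Icc a b, HasDerivWithinAt δ (g u - A (δ u)) (Set.Icc a b) u)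
    (hquad : ∀ u ∈ Set.Icc a b, β * ⟪δ u, P (δ u)⟫ ≤ 2 * ⟪P (δ u), A (δ u)⟫) :
    ∀ u ∈ Set.Icc a b,
      ‖δ u‖ ≤ Real.sqrt (M / m) * Real.exp ((-β / 2 + ρ * (M / m)) * (u - a)) * ‖δ a‖ := by
  intro u hu
  have hV : ∀ s ∈ Set.Icc a b, HasDerivWithinAt (fun t ↦ ⟪δ t, P (δ t)⟫)
      (2 * ⟪P (δ s), g s - A (δ s)⟫) (Set.Icc a b) s := by
    intro s hs
    have hd := (hode s hs).inner ℝ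
      (P.hasFDerivAt.comp_hasDerivWithinAt s (hode s hs))
    refine hd.congr_deriv ?_
    have hsymm : ⟪P (δ s), g s - A (δ s)⟫ = ⟪δ s, P (g s - A (δ s))⟫ := hP _ _
    simp only [Function.comp_apply]
    rw [real_inner_comm (P (δ s)), ← hsymm, two_mul]
  have hle : ∀ s ∈ Set.Icc a b, 2 * ⟪P (δ s), g s - A (δ s)⟫ ≤
      (-β + 2 * ρ * (M / m)) * ⟪δ s, P (δ s)⟫ := by
    intro s hs
    have hinner : ⟪P (δ s), g s⟫ ≤ ρ * (M / m) * ⟪δ s, P (δ s)⟫ :=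
      calc ⟪P (δ s), g s⟫ ≤ ‖P (δ s)‖ * ‖g s‖ := real_inner_le_norm _ _
        _ ≤ (M * ‖δ s‖) * (ρ * ‖δ s‖) := by
          gcongr
          exacts [hPM _, hg s hs]
        _ = ρ * (M / m) * (m * ‖δ s‖ ^ 2) := by field_simp
        _ ≤ _ := by
          gcongr
          exact hmP _
    rw [inner_sub_right]
    linarith [hquad s hs]
  have hgron := le_exp_mul_of_hasDerivWithinAt_le hV hle u hu
  have hinit : ⟪δ a, P (δ a)⟫ ≤ M * ‖δ a‖ ^ 2 :=
    calc ⟪δ a, P (δ a)⟫ ≤ ‖δ a‖ * ‖P (δ a)‖ := real_inner_le_norm _ _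
      _ ≤ ‖δ a‖ * (M * ‖δ a‖) := by
        gcongr
        exact hPM _
      _ = _ := by ring
  refine le_of_sq_le_sq ?_ (by positivity)
  rw [mul_pow, mul_pow, Real.sq_sqrt (by positivity), ← Real.exp_nat_mul]
  refine le_of_mul_le_mul_left ?_ hm
  calc m * ‖δ u‖ ^ 2 ≤ ⟪δ u, P (δ u)⟫ := hmP _
    _ ≤ Real.exp ((-β + 2 * ρ * (M / m)) * (u - a)) * (M * ‖δ a‖ ^ 2) :=
      hgron.trans (by gcongr)
    _ = Real.exp (((2 : ℕ) : ℝ) * ((-β / 2 + ρ * (M / m)) * (u - a))) * (M * ‖δ a‖ ^ 2) := by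
      congr 2
      push_cast
      ring
    _ = _ := by field_simp

namespace Matrix

variable {ι : Type*} [Fintype ι] [DecidableEq ι]

theorem isSymmetric_toEuclideanLin_diagonal (d : ι → ℝ) :
    (toEuclideanLin (diagonal d)).IsSymmetric :=
  isSymmetric_toEuclideanLin_iff.2 (isHermitian_diagonal d)

theorem norm_toEuclideanLin_diagonal_le {d : ι → ℝ} {M : ℝ} (hd : ∀ i, |d i| ≤ M) (hM : 0 ≤ M)
    (x : EuclideanSpace ℝ ι) : ‖toEuclideanLin (diagonal d) x‖ ≤ M * ‖x‖ := by
  refine le_of_sq_le_sq ?_ (by positivity)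
  rw [mul_pow, EuclideanSpace.real_norm_sq_eq, EuclideanSpace.real_norm_sq_eq, Finset.mul_sum]
  refine Finset.sum_le_sum fun i _ ↦ ?_
  simp only [toLpLin_apply, mulVec_diagonal, mul_pow]
  refine mul_le_mul_of_nonneg_right ?_ (sq_nonneg (x i))
  exact sq_le_sq.2 ((hd i).trans (le_abs_self M))

theorem mul_norm_sq_le_inner_toEuclideanLin_diagonal {d : ι → ℝ} {m : ℝ} (hd : ∀ i, m ≤ d i)
    (x : EuclideanSpace ℝ ι) : m * ‖x‖ ^ 2 ≤ ⟪x, toEuclideanLin (diagonal d) x⟫ := by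
  rw [EuclideanSpace.real_norm_sq_eq, Finset.mul_sum, PiLp.inner_apply]
  refine Finset.sum_le_sum fun i _ ↦ ?_
  simp only [toLpLin_apply, mulVec_diagonal, RCLike.inner_apply, conj_trivial]
  nlinarith [hd i, sq_nonneg (x i)]

/-- The quadratic form of `P * A + Aᵀ * P` for symmetric `P`. -/
theorem inner_toEuclideanLin_mul_add_transpose_mul {P : Matrix ι ι ℝ} (hP : P.IsSymm)
    (A : Matrix ι ι ℝ) (x : EuclideanSpace ℝ ι) :
    ⟪x, toEuclideanLin (P * A + Aᵀ * P) x⟫ = 2 * ⟪toEuclideanLin P x, toEuclideanLin A x⟫ := by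
  have htr (B C : Matrix ι ι ℝ) :
      ⟪x, toEuclideanLin (Bᵀ * C) x⟫ = ⟪toEuclideanLin B x, toEuclideanLin C x⟫ := by
    simp only [EuclideanSpace.inner_eq_star_dotProduct, toLpLin_apply, star_trivial,
      ← mulVec_mulVec]
    rw [mulVec_transpose, ← dotProduct_mulVec]
  have h := htr P A
  rw [hP.eq] at h
  rw [map_add, LinearMap.add_apply, inner_add_right, h, htr, real_inner_comm, two_mul]

end Matrix

/-- **Exponential decay estimate for the projected error** (the Lyapunov estimate
`‖δ(t)‖ ≤ √c · exp{(−φαλ_min(Γ)/2 + ρ̄c)(t − t₀)}‖δ(t₀)‖`).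

Here `Γ = diagonal Γd` and `Ξ = diagonal Ξd` have positive diagonal entries,
`c = λ_max(Ξ)/λ_min(Ξ)`, `δ` solves `δ' = g − φ (L ⊗ Γ) δ` on `[t₀, t₁]` with
`‖g(t)‖ ≤ ρ̄ ‖δ(t)‖`, and the quadratic-form bound
`δᵀ[(ΞL + LᵀΞ) ⊗ Γ]δ ≥ α λ_min(Γ) δᵀ(Ξ ⊗ I)δ` holds. -/
theorem projected_error_exponential_decay
    {N n : ℕ} (hN : 1 ≤ N) (hn : 1 ≤ n)
    (L : Matrix (Fin N) (Fin N) ℝ)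
    (Γd : Fin n → ℝ) (hΓ : ∀ l, 0 < Γd l)
    (Ξd : Fin N → ℝ) (hΞ : ∀ i, 0 < Ξd i)
    (α ρ φ : ℝ) (hα : 0 < α) (hρ : 0 ≤ ρ) (hφ : 0 < φ)
    (t₀ t₁ : ℝ) (ht : t₀ < t₁)
    (δ g : ℝ → EuclideanSpace ℝ (Fin N × Fin n))
    (hg : ∀ u ∈ Set.Icc t₀ t₁, ‖g u‖ ≤ ρ * ‖δ u‖)
    (hode : ∀ u ∈ Set.Icc t₀ t₁,
      HasDerivWithinAt δ
        (g u - φ • Matrix.toEuclideanLin (L ⊗ₖ Matrix.diagonal Γd) (δ u))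
        (Set.Icc t₀ t₁) u)
    (hquad : ∀ u ∈ Set.Icc t₀ t₁,
      α * (⨅ l, Γd l) *
          ⟪δ u, Matrix.toEuclideanLin
            (Matrix.diagonal Ξd ⊗ₖ (1 : Matrix (Fin n) (Fin n) ℝ)) (δ u)⟫ ≤
        ⟪δ u, Matrix.toEuclideanLin
          ((Matrix.diagonal Ξd * L + Lᵀ * Matrix.diagonal Ξd) ⊗ₖ
            Matrix.diagonal Γd) (δ u)⟫) :
    ∀ u ∈ Set.Icc t₀ t₁,
      ‖δ u‖ ≤ Real.sqrt ((⨆ i, Ξd i) / (⨅ i, Ξd i)) *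
        Real.exp ((-(φ * α * (⨅ l, Γd l)) / 2 + ρ * ((⨆ i, Ξd i) / (⨅ i, Ξd i))) *
          (u - t₀)) * ‖δ t₀‖ := by
  have : Nonempty (Fin N) := ⟨⟨0, hN⟩⟩
  have hbelow (i : Fin N) : ⨅ i, Ξd i ≤ Ξd i := ciInf_le (Set.finite_range Ξd).bddBelow i
  have habove (i : Fin N) : Ξd i ≤ ⨆ i, Ξd i := le_ciSup (Set.finite_range Ξd).bddAbove i
  have hm : 0 < ⨅ i, Ξd i := by
    obtain ⟨i, hi⟩ := exists_eq_ciInf_of_finite (f := Ξd)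
    exact hi ▸ hΞ i
  have hM : 0 ≤ ⨆ i, Ξd i := (hΞ ⟨0, hN⟩).le.trans (habove _)
  have hdiag : diagonal Ξd ⊗ₖ (1 : Matrix (Fin n) (Fin n) ℝ) =
      diagonal fun p : Fin N × Fin n ↦ Ξd p.1 := by
    rw [← diagonal_one, diagonal_kronecker_diagonal]
    simp
  have hlyap : (diagonal Ξd * L + Lᵀ * diagonal Ξd) ⊗ₖ diagonal Γd =
      (diagonal fun p : Fin N × Fin n ↦ Ξd p.1) * (L ⊗ₖ diagonal Γd) +
        (L ⊗ₖ diagonal Γd)ᵀ * diagonal fun p : Fin N × Fin n ↦ Ξd p.1 := by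
    rw [← hdiag, add_kronecker, ← kroneckerMap_transpose, ← mul_kronecker_mul,
      ← mul_kronecker_mul, diagonal_transpose, one_mul, mul_one]
  refine norm_le_of_quadratic_lyapunov
    (P := (toEuclideanLin (diagonal fun p : Fin N × Fin n ↦ Ξd p.1)).toContinuousLinearMap)
    (A := fun x ↦ φ • toEuclideanLin (L ⊗ₖ diagonal Γd) x)
    (isSymmetric_toEuclideanLin_diagonal _) hm hρ
    (mul_norm_sq_le_inner_toEuclideanLin_diagonal fun p ↦ hbelow p.1)
    (norm_toEuclideanLin_diagonal_le (fun p ↦ (abs_of_pos (hΞ p.1)).trans_le (habove p.1)) hM)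
    hM hg hode fun u hu ↦ ?_
  have h := hquad u hu
  rw [hdiag, hlyap, inner_toEuclideanLin_mul_add_transpose_mul (diagonal_transpose _)] at h
  simp only [LinearMap.coe_toContinuousLinearMap', inner_smul_right]
  linarith [mul_le_mul_of_nonneg_left h hφ.le]
end
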